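/- arXiv:2309.15735 — 3 statements merged into one kernel-verified Lean document; each statement's English description precedes it below -/
import Mathlib

section
/- Let X and Y be real-valued random variables with cumulative distribution functions F_X and F_Y, let F_X^{-1} and F_Y^{-1} denote their generalized inverse (quantile) functions, and let U be uniformly distributed on (0,1). Let ψ : ℝ² → ℝ be a supermodular function (i.e. ψ(x₁,y₁) + ψ(x₂,y₂) ≥ ψ(x₁,y₂) + ψ(x₂,y₁) whenever x₁ ≤ x₂ and y₁ ≤ y₂) that is right-continuous, and assume ψ(X',Y') is integrable for every pair (X',Y') whose joint law is a coupling of the laws of X and Y. Then the supremum of E[ψ(X',Y')] over all couplings (X',Y') of the laws of X and Y equals E[ψ(F_X^{-1}(U), F_Y^{-1}(U))]. -/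
open MeasureTheory Set

/-- A coupling of two probability laws `μ` and `ν` on `ℝ`: a joint law on `ℝ × ℝ`
whose first marginal is `μ` and second marginal is `ν`. -/
def IsCoupling (γ : Measure (ℝ × ℝ)) (μ ν : Measure ℝ) : Prop :=
  γ.map Prod.fst = μ ∧ γ.map Prod.snd = ν

/-- Generalized inverse (quantile function) of a CDF `F`. -/
noncomputable def qf (F : ℝ → ℝ) (u : ℝ) : ℝ := sInf {x | u ≤ F x}

/-- The CDF of a probability law `μ` on `ℝ`. -/
noncomputable def cdfOf (μ : Measure ℝ) (x : ℝ) : ℝ := (μ (Iic x)).toReal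

open Filter Topology

/-- The part of `ψ` left after subtracting its sections through `(x₀, y₀)`. -/
def centered (ψ : ℝ → ℝ → ℝ) (x₀ y₀ x y : ℝ) : ℝ :=
  ψ x y - ψ x₀ y - ψ x y₀ + ψ x₀ y₀

/-- Projection of `x` on the interval `[x₀ - M, x₀ + M]`. -/
def clamp (x₀ : ℝ) (M : ℕ) (x : ℝ) : ℝ :=
  (x₀ - M) + min (max (x - (x₀ - M)) 0) (2 * M)

/-- Index of the grid point of mesh `1 / (n + 1)` just above `clamp x₀ M x`. -/
noncomputable def gridIndex (x₀ : ℝ) (M n : ℕ) (x : ℝ) : ℕ :=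
  min ⌈max (x - (x₀ - M)) 0 * ((n : ℝ) + 1)⌉₊ (2 * M * (n + 1))

/-- The `i`-th point of the grid of mesh `1 / (n + 1)` starting at `x₀ - M`. -/
noncomputable def gridPoint (x₀ : ℝ) (M n i : ℕ) : ℝ :=
  (x₀ - M) + (i : ℝ) / ((n : ℝ) + 1)

section Supermodular

variable {ψ : ℝ → ℝ → ℝ}

lemma abs_centered_le
    (hsuper : ∀ x₁ x₂ y₁ y₂ : ℝ, x₁ ≤ x₂ → y₁ ≤ y₂ →
      ψ x₁ y₂ + ψ x₂ y₁ ≤ ψ x₁ y₁ + ψ x₂ y₂)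
    {x₀ y₀ x y x' y' : ℝ} (hx : x ∈ uIcc x₀ x') (hy : y ∈ uIcc y₀ y') :
    |centered ψ x₀ y₀ x y| ≤ |centered ψ x₀ y₀ x' y'| := by
  unfold centered
  rcases mem_uIcc.1 hx with ⟨h1, h2⟩ | ⟨h1, h2⟩ <;>
  rcases mem_uIcc.1 hy with ⟨h3, h4⟩ | ⟨h3, h4⟩
  · have a := hsuper _ _ _ _ h1 h3
    have b := hsuper _ _ _ _ h2 h3
    have c := hsuper _ _ _ _ (h1.trans h2) h4
    rw [abs_of_nonneg (by linarith), abs_of_nonneg (by linarith)]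
    linarith
  · have a := hsuper _ _ _ _ h1 h4
    have b := hsuper _ _ _ _ h2 h4
    have c := hsuper _ _ _ _ (h1.trans h2) h3
    rw [abs_of_nonpos (by linarith), abs_of_nonpos (by linarith)]
    linarith
  · have a := hsuper _ _ _ _ h2 h3
    have b := hsuper _ _ _ _ h1 h3
    have c := hsuper _ _ _ _ (h1.trans h2) h4
    rw [abs_of_nonpos (by linarith), abs_of_nonpos (by linarith)]
    linarith
  · have a := hsuper _ _ _ _ h2 h4
    have b := hsuper _ _ _ _ h1 h4
    have c := hsuper _ _ _ _ (h1.trans h2) h3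
    rw [abs_of_nonneg (by linarith), abs_of_nonneg (by linarith)]
    linarith

lemma abs_centered_le_of_mem_box
    (hsuper : ∀ x₁ x₂ y₁ y₂ : ℝ, x₁ ≤ x₂ → y₁ ≤ y₂ →
      ψ x₁ y₂ + ψ x₂ y₁ ≤ ψ x₁ y₁ + ψ x₂ y₂)
    {x₀ y₀ x y r : ℝ} (hx : x ∈ Icc (x₀ - r) (x₀ + r)) (hy : y ∈ Icc (y₀ - r) (y₀ + r)) :
    |centered ψ x₀ y₀ x y| ≤
      |centered ψ x₀ y₀ (x₀ - r) (y₀ - r)| + |centered ψ x₀ y₀ (x₀ - r) (y₀ + r)| +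
      |centered ψ x₀ y₀ (x₀ + r) (y₀ - r)| + |centered ψ x₀ y₀ (x₀ + r) (y₀ + r)| := by
  have key := fun {x' y'} (hx : x ∈ uIcc x₀ x') (hy : y ∈ uIcc y₀ y') =>
    abs_centered_le hsuper hx hy
  have p1 := abs_nonneg (centered ψ x₀ y₀ (x₀ - r) (y₀ - r))
  have p2 := abs_nonneg (centered ψ x₀ y₀ (x₀ - r) (y₀ + r))
  have p3 := abs_nonneg (centered ψ x₀ y₀ (x₀ + r) (y₀ - r))
  have p4 := abs_nonneg (centered ψ x₀ y₀ (x₀ + r) (y₀ + r))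
  rcases le_total x x₀ with h1 | h1 <;> rcases le_total y y₀ with h2 | h2
  · linarith [key (mem_uIcc.2 (Or.inr ⟨hx.1, h1⟩)) (mem_uIcc.2 (Or.inr ⟨hy.1, h2⟩))]
  · linarith [key (mem_uIcc.2 (Or.inr ⟨hx.1, h1⟩)) (mem_uIcc.2 (Or.inl ⟨h2, hy.2⟩))]
  · linarith [key (mem_uIcc.2 (Or.inl ⟨h1, hx.2⟩)) (mem_uIcc.2 (Or.inr ⟨hy.1, h2⟩))]
  · linarith [key (mem_uIcc.2 (Or.inl ⟨h1, hx.2⟩)) (mem_uIcc.2 (Or.inl ⟨h2, hy.2⟩))]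

lemma continuousWithinAt_centered
    (hrc : ∀ x y : ℝ,
      ContinuousWithinAt (fun p : ℝ × ℝ => ψ p.1 p.2) (Ici x ×ˢ Ici y) (x, y))
    (x₀ y₀ x y : ℝ) :
    ContinuousWithinAt (fun p : ℝ × ℝ => centered ψ x₀ y₀ p.1 p.2)
      (Ici x ×ˢ Ici y) (x, y) := by
  have h1 : ContinuousWithinAt (fun p : ℝ × ℝ => ψ x₀ p.2) (Ici x ×ˢ Ici y) (x, y) :=
    ContinuousWithinAt.comp (f := fun p : ℝ × ℝ => (x₀, p.2)) (x := (x, y)) (hrc x₀ y)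
      (by fun_prop) (fun p hp => ⟨mem_Ici.2 le_rfl, hp.2⟩)
  have h2 : ContinuousWithinAt (fun p : ℝ × ℝ => ψ p.1 y₀) (Ici x ×ˢ Ici y) (x, y) :=
    ContinuousWithinAt.comp (f := fun p : ℝ × ℝ => (p.1, y₀)) (x := (x, y)) (hrc x y₀)
      (by fun_prop) (fun p hp => ⟨hp.1, mem_Ici.2 le_rfl⟩)
  exact (((hrc x y).sub h1).sub h2).add continuousWithinAt_const

end Supermodular

section Grid

lemma clamp_mem_uIcc (x₀ : ℝ) (M : ℕ) (x : ℝ) : clamp x₀ M x ∈ uIcc x₀ x := by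
  have hM : (0 : ℝ) ≤ M := M.cast_nonneg
  rw [mem_uIcc]
  unfold clamp
  rcases max_cases (x - (x₀ - M)) 0 with ⟨h, h'⟩ | ⟨h, h'⟩ <;> rw [h]
  · rcases min_cases (x - (x₀ - M)) (2 * M) with ⟨k, k'⟩ | ⟨k, k'⟩ <;> rw [k]
    · rcases le_total x₀ x with l | l
      · left; constructor <;> linarith
      · right; constructor <;> linarith
    · left; constructor <;> linarith
  · rw [min_eq_left (by linarith)]
    right; constructor <;> linarith

lemma eventually_clamp_eq (x₀ x : ℝ) : ∀ᶠ M : ℕ in atTop, clamp x₀ M x = x := by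
  filter_upwards [tendsto_natCast_atTop_atTop.eventually_ge_atTop |x - x₀|] with M hM
  have := abs_le.1 hM
  unfold clamp
  rw [max_eq_left (by linarith), min_eq_left (by linarith)]
  ring

lemma gridPoint_gridIndex (x₀ : ℝ) (M n : ℕ) (x : ℝ) :
    gridPoint x₀ M n (gridIndex x₀ M n x) = (x₀ - M) +
      min ((⌈max (x - (x₀ - M)) 0 * ((n : ℝ) + 1)⌉₊ : ℝ) / ((n : ℝ) + 1)) (2 * M) := by
  have hn : (0 : ℝ) < (n : ℝ) + 1 := by positivity
  unfold gridPoint gridIndex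
  rw [Nat.cast_min, ← min_div_div_right hn.le]
  push_cast
  rw [mul_div_cancel_right₀ _ hn.ne']

lemma clamp_le_gridPoint (x₀ : ℝ) (M n : ℕ) (x : ℝ) :
    clamp x₀ M x ≤ gridPoint x₀ M n (gridIndex x₀ M n x) := by
  have hn : (0 : ℝ) < (n : ℝ) + 1 := by positivity
  rw [gridPoint_gridIndex, clamp]
  gcongr
  rw [le_div_iff₀ hn]
  exact Nat.le_ceil _

lemma gridPoint_mem_Icc (x₀ : ℝ) (M n : ℕ) (x : ℝ) :
    gridPoint x₀ M n (gridIndex x₀ M n x) ∈ Icc (x₀ - M) (x₀ + M) := by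
  rw [gridPoint_gridIndex]
  constructor
  · have : 0 ≤ min ((⌈max (x - (x₀ - M)) 0 * ((n : ℝ) + 1)⌉₊ : ℝ) / ((n : ℝ) + 1))
        (2 * M) := by positivity
    linarith
  · linarith [min_le_right
      ((⌈max (x - (x₀ - M)) 0 * ((n : ℝ) + 1)⌉₊ : ℝ) / ((n : ℝ) + 1)) (2 * M : ℝ)]

lemma tendsto_gridPoint (x₀ : ℝ) (M : ℕ) (x : ℝ) :
    Tendsto (fun n => gridPoint x₀ M n (gridIndex x₀ M n x)) atTop (𝓝 (clamp x₀ M x)) := by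
  simp only [gridPoint_gridIndex, clamp]
  have h := (tendsto_nat_ceil_mul_div_atTop (R := ℝ) (le_max_right (x - (x₀ - M)) 0)).comp
    (tendsto_atTop_add_const_right atTop (1 : ℝ) tendsto_natCast_atTop_atTop)
  exact (h.min tendsto_const_nhds).const_add _

lemma monotone_gridIndex (x₀ : ℝ) (M n : ℕ) : Monotone (gridIndex x₀ M n) := by
  intro x y h
  unfold gridIndex
  gcongr

lemma monotone_gridPoint (x₀ : ℝ) (M n : ℕ) : Monotone (gridPoint x₀ M n) := by
  intro i j h
  unfold gridPoint
  gcongr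

lemma tendsto_centered_gridPoint {ψ : ℝ → ℝ → ℝ}
    (hrc : ∀ x y : ℝ,
      ContinuousWithinAt (fun p : ℝ × ℝ => ψ p.1 p.2) (Ici x ×ˢ Ici y) (x, y))
    (x₀ y₀ : ℝ) (M : ℕ) (x y : ℝ) :
    Tendsto (fun n => centered ψ x₀ y₀ (gridPoint x₀ M n (gridIndex x₀ M n x))
      (gridPoint y₀ M n (gridIndex y₀ M n y))) atTop
      (𝓝 (centered ψ x₀ y₀ (clamp x₀ M x) (clamp y₀ M y))) := by
  have h := continuousWithinAt_centered hrc x₀ y₀ (clamp x₀ M x) (clamp y₀ M y)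
  refine h.tendsto.comp (tendsto_nhdsWithin_iff.2
    ⟨(tendsto_gridPoint x₀ M x).prodMk_nhds (tendsto_gridPoint y₀ M y), ?_⟩)
  exact Eventually.of_forall fun n =>
    ⟨clamp_le_gridPoint x₀ M n x, clamp_le_gridPoint y₀ M n y⟩

end Grid

/-- Double summation by parts. -/
lemma eq_add_sum_increments (Φ : ℕ → ℕ → ℝ) {N i j : ℕ} (hi : i ≤ N) (hj : j ≤ N) :
    Φ i j = Φ i 0 + Φ 0 j - Φ 0 0 + ∑ k ∈ Finset.range N, ∑ l ∈ Finset.range N,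
      (Φ (k + 1) (l + 1) - Φ (k + 1) l - Φ k (l + 1) + Φ k l) *
        (if k < i ∧ l < j then 1 else 0) := by
  have inner : ∀ k, ∑ l ∈ Finset.range N,
      (Φ (k + 1) (l + 1) - Φ (k + 1) l - Φ k (l + 1) + Φ k l) *
        (if k < i ∧ l < j then 1 else 0) =
      if k < i then (Φ (k + 1) j - Φ k j) - (Φ (k + 1) 0 - Φ k 0) else 0 := by
    intro k
    split_ifs with hk
    · have : ∀ m, m ≤ N → ∑ l ∈ Finset.range m,
          (Φ (k + 1) (l + 1) - Φ (k + 1) l - Φ k (l + 1) + Φ k l) *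
            (if k < i ∧ l < j then 1 else 0) =
          (Φ (k + 1) (min m j) - Φ k (min m j)) - (Φ (k + 1) 0 - Φ k 0) := by
        intro m
        induction m with
        | zero => simp
        | succ m ih =>
          intro hm
          rw [Finset.sum_range_succ, ih (by omega)]
          by_cases h : m < j
          · rw [min_eq_left h.le, min_eq_left (by omega), if_pos ⟨hk, h⟩]; ring
          · rw [min_eq_right (by omega), min_eq_right (by omega), if_neg (by tauto)]; ring
      rw [this N le_rfl, min_eq_right hj]
    · simp [hk]
  simp only [inner]
  have outer : ∀ m, ∑ k ∈ Finset.range m,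
      (if k < i then (Φ (k + 1) j - Φ k j) - (Φ (k + 1) 0 - Φ k 0) else 0) =
      (Φ (min m i) j - Φ (min m i) 0) - (Φ 0 j - Φ 0 0) := by
    intro m
    induction m with
    | zero => simp
    | succ m ih =>
      rw [Finset.sum_range_succ, ih]
      by_cases h : m < i
      · rw [min_eq_left h.le, min_eq_left (by omega), if_pos h]; ring
      · rw [min_eq_right (by omega), min_eq_right (by omega), if_neg h]; ring
  rw [outer, min_eq_right hi]
  ring

section Couplings

variable {μ ν : Measure ℝ} {γ γ' : Measure (ℝ × ℝ)}

lemma IsCoupling.measurePreserving_fst (h : IsCoupling γ μ ν) :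
    MeasurePreserving Prod.fst γ μ := ⟨measurable_fst, h.1⟩

lemma IsCoupling.measurePreserving_snd (h : IsCoupling γ μ ν) :
    MeasurePreserving Prod.snd γ ν := ⟨measurable_snd, h.2⟩

lemma IsCoupling.isProbabilityMeasure [IsProbabilityMeasure μ] (h : IsCoupling γ μ ν) :
    IsProbabilityMeasure γ := by
  constructor
  have := h.measurePreserving_fst.measure_preimage (s := univ) nullMeasurableSet_univ
  simpa using this

lemma IsCoupling.integral_fst (h : IsCoupling γ μ ν) {f : ℝ → ℝ}
    (hf : AEStronglyMeasurable f μ) : ∫ p, f p.1 ∂γ = ∫ x, f x ∂μ := by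
  rw [← h.1] at hf ⊢
  exact (integral_map measurable_fst.aemeasurable hf).symm

lemma IsCoupling.integral_snd (h : IsCoupling γ μ ν) {f : ℝ → ℝ}
    (hf : AEStronglyMeasurable f ν) : ∫ p, f p.2 ∂γ = ∫ x, f x ∂ν := by
  rw [← h.2] at hf ⊢
  exact (integral_map measurable_snd.aemeasurable hf).symm

/-- Comparison of integrals of supermodular functions of finitely many monotone indices. -/
lemma integral_index_le [IsProbabilityMeasure μ]
    (h : IsCoupling γ μ ν) (h' : IsCoupling γ' μ ν)
    (hupper : ∀ A B : Set ℝ, IsUpperSet A → IsUpperSet B →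
      MeasurableSet A → MeasurableSet B → γ.real (A ×ˢ B) ≤ γ'.real (A ×ˢ B))
    (Φ : ℕ → ℕ → ℝ)
    (hΦ : ∀ k l, 0 ≤ Φ (k + 1) (l + 1) - Φ (k + 1) l - Φ k (l + 1) + Φ k l)
    {N : ℕ} {I J : ℝ → ℕ} (hI : Monotone I) (hJ : Monotone J)
    (hIN : ∀ x, I x ≤ N) (hJN : ∀ x, J x ≤ N) :
    ∫ p, Φ (I p.1) (J p.2) ∂γ ≤ ∫ p, Φ (I p.1) (J p.2) ∂γ' := by
  have hmA : ∀ k, MeasurableSet {x | k < I x} := fun k =>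
    measurableSet_lt measurable_const hI.measurable
  have hmB : ∀ l, MeasurableSet {x | l < J x} := fun l =>
    measurableSet_lt measurable_const hJ.measurable
  have hbdd : ∀ g : ℕ → ℝ, ∃ C, ∀ i ≤ N, ‖g i‖ ≤ C := by
    intro g
    refine ⟨∑ i ∈ Finset.range (N + 1), ‖g i‖, fun i hi => ?_⟩
    exact Finset.single_le_sum (f := fun i => ‖g i‖) (fun _ _ => norm_nonneg _)
      (Finset.mem_range.2 (by omega))
  have formula : ∀ {δ : Measure (ℝ × ℝ)}, IsCoupling δ μ ν →
      ∫ p, Φ (I p.1) (J p.2) ∂δ =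
        (∫ x, Φ (I x) 0 ∂μ) + (∫ y, Φ 0 (J y) ∂ν) - Φ 0 0 +
        ∑ k ∈ Finset.range N, ∑ l ∈ Finset.range N,
          (Φ (k + 1) (l + 1) - Φ (k + 1) l - Φ k (l + 1) + Φ k l) *
            δ.real ({x | k < I x} ×ˢ {y | l < J y}) := by
    intro δ hδ
    have := hδ.isProbabilityMeasure
    have m1 : Measurable fun x => Φ (I x) 0 :=
      (measurable_from_top (f := fun i => Φ i 0)).comp hI.measurable
    have m2 : Measurable fun x => Φ 0 (J x) :=
      (measurable_from_top (f := fun i => Φ 0 i)).comp hJ.measurable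
    obtain ⟨C1, hC1⟩ := hbdd fun i => Φ i 0
    obtain ⟨C2, hC2⟩ := hbdd fun i => Φ 0 i
    have i1 : Integrable (fun p : ℝ × ℝ => Φ (I p.1) 0) δ :=
      Integrable.of_bound (m1.comp measurable_fst).aestronglyMeasurable C1
        (Eventually.of_forall fun p => hC1 _ (hIN _))
    have i2 : Integrable (fun p : ℝ × ℝ => Φ 0 (J p.2)) δ :=
      Integrable.of_bound (m2.comp measurable_snd).aestronglyMeasurable C2
        (Eventually.of_forall fun p => hC2 _ (hJN _))
    have hind : ∀ k l, (fun p : ℝ × ℝ => if k < I p.1 ∧ l < J p.2 then (1 : ℝ) else 0) =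
        ({x | k < I x} ×ˢ {y | l < J y}).indicator 1 := by
      intro k l
      ext p
      simp [indicator_apply]
    have i3 : ∀ k l, Integrable
        (fun p : ℝ × ℝ => (Φ (k + 1) (l + 1) - Φ (k + 1) l - Φ k (l + 1) + Φ k l) *
          (if k < I p.1 ∧ l < J p.2 then (1 : ℝ) else 0)) δ := by
      intro k l
      refine Integrable.const_mul ?_ _
      rw [hind]
      exact (integrable_const (1 : ℝ)).indicator ((hmA k).prod (hmB l))
    have hexp : (fun p : ℝ × ℝ => Φ (I p.1) (J p.2)) = fun p => _ :=
      funext fun p => eq_add_sum_increments Φ (hIN p.1) (hJN p.2)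
    have i12 : Integrable (fun p : ℝ × ℝ => Φ (I p.1) 0 + Φ 0 (J p.2)) δ := i1.add i2
    have i120 : Integrable (fun p : ℝ × ℝ => Φ (I p.1) 0 + Φ 0 (J p.2) - Φ 0 0) δ :=
      i12.sub (integrable_const _)
    rw [hexp, integral_add i120
      (integrable_finsetSum _ fun k _ => integrable_finsetSum _ fun l _ => i3 k l),
      integral_sub i12 (integrable_const _), integral_add i1 i2,
      hδ.integral_fst m1.aestronglyMeasurable, hδ.integral_snd m2.aestronglyMeasurable,
      integral_finsetSum _ fun k _ => integrable_finsetSum _ fun l _ => i3 k l]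
    congr 1
    · simp
    · refine Finset.sum_congr rfl fun k _ => ?_
      rw [integral_finsetSum _ fun l _ => i3 k l]
      refine Finset.sum_congr rfl fun l _ => ?_
      rw [integral_const_mul, hind, integral_indicator_one ((hmA k).prod (hmB l))]
  rw [formula h, formula h']
  gcongr with k _ l _
  · exact hΦ k l
  · exact hupper _ _ (fun x y hxy hx => lt_of_lt_of_le hx (hI hxy))
      (fun x y hxy hx => lt_of_lt_of_le hx (hJ hxy)) (hmA k) (hmB l)

lemma integral_centered_le [IsProbabilityMeasure μ]
    (h : IsCoupling γ μ ν) (h' : IsCoupling γ' μ ν)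
    (hupper : ∀ A B : Set ℝ, IsUpperSet A → IsUpperSet B →
      MeasurableSet A → MeasurableSet B → γ.real (A ×ˢ B) ≤ γ'.real (A ×ˢ B))
    {ψ : ℝ → ℝ → ℝ}
    (hsuper : ∀ x₁ x₂ y₁ y₂ : ℝ, x₁ ≤ x₂ → y₁ ≤ y₂ →
      ψ x₁ y₂ + ψ x₂ y₁ ≤ ψ x₁ y₁ + ψ x₂ y₂)
    (hrc : ∀ x y : ℝ,
      ContinuousWithinAt (fun p : ℝ × ℝ => ψ p.1 p.2) (Ici x ×ˢ Ici y) (x, y))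
    (x₀ y₀ : ℝ)
    (hint : Integrable (fun p => centered ψ x₀ y₀ p.1 p.2) γ)
    (hint' : Integrable (fun p => centered ψ x₀ y₀ p.1 p.2) γ') :
    ∫ p, centered ψ x₀ y₀ p.1 p.2 ∂γ ≤ ∫ p, centered ψ x₀ y₀ p.1 p.2 ∂γ' := by
  let G : ℕ → ℕ → ℝ × ℝ → ℝ := fun M n p =>
    centered ψ x₀ y₀ (gridPoint x₀ M n (gridIndex x₀ M n p.1))
      (gridPoint y₀ M n (gridIndex y₀ M n p.2))
  let T : ℕ → ℝ × ℝ → ℝ := fun M p =>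
    centered ψ x₀ y₀ (clamp x₀ M p.1) (clamp y₀ M p.2)
  have hGmeas : ∀ M n, Measurable (G M n) := by
    intro M n
    have hidx : Measurable fun p : ℝ × ℝ => (gridIndex x₀ M n p.1, gridIndex y₀ M n p.2) :=
      ((monotone_gridIndex x₀ M n).measurable.comp measurable_fst).prodMk
        ((monotone_gridIndex y₀ M n).measurable.comp measurable_snd)
    have hq : Measurable fun q : ℕ × ℕ =>
        centered ψ x₀ y₀ (gridPoint x₀ M n q.1) (gridPoint y₀ M n q.2) :=
      measurable_of_countable _
    have hcomp := hq.comp hidx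
    exact hcomp
  have hGlim : ∀ M p, Tendsto (fun n => G M n p) atTop (𝓝 (T M p)) := fun M p =>
    tendsto_centered_gridPoint hrc x₀ y₀ M p.1 p.2
  have hTmeas : ∀ M, Measurable (T M) := fun M =>
    measurable_of_tendsto_metrizable (hGmeas M) (tendsto_pi_nhds.2 (hGlim M))
  have hGint : ∀ {δ : Measure (ℝ × ℝ)}, IsCoupling δ μ ν → ∀ M,
      Tendsto (fun n => ∫ p, G M n p ∂δ) atTop (𝓝 (∫ p, T M p ∂δ)) := by
    intro δ hδ M
    have := hδ.isProbabilityMeasure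
    exact tendsto_integral_of_dominated_convergence (fun _ => _)
      (fun n => (hGmeas M n).aestronglyMeasurable) (integrable_const _)
      (fun n => Eventually.of_forall fun p => abs_centered_le_of_mem_box hsuper
        (gridPoint_mem_Icc x₀ M n p.1) (gridPoint_mem_Icc y₀ M n p.2))
      (Eventually.of_forall (hGlim M))
  have hTint : ∀ {δ : Measure (ℝ × ℝ)},
      Integrable (fun p => centered ψ x₀ y₀ p.1 p.2) δ →
      Tendsto (fun M => ∫ p, T M p ∂δ) atTop
        (𝓝 (∫ p, centered ψ x₀ y₀ p.1 p.2 ∂δ)) := by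
    intro δ hδ
    refine tendsto_integral_of_dominated_convergence
      (fun p => ‖centered ψ x₀ y₀ p.1 p.2‖)
      (fun M => (hTmeas M).aestronglyMeasurable) hδ.norm
      (fun M => Eventually.of_forall fun p => abs_centered_le hsuper
        (clamp_mem_uIcc x₀ M p.1) (clamp_mem_uIcc y₀ M p.2))
      (Eventually.of_forall fun p => tendsto_const_nhds.congr' ?_)
    filter_upwards [eventually_clamp_eq x₀ p.1, eventually_clamp_eq y₀ p.2] with M h1 h2
    simp only [T, h1, h2]
  refine le_of_tendsto_of_tendsto' (hTint hint) (hTint hint') fun M =>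
    le_of_tendsto_of_tendsto' (hGint h M) (hGint h' M) fun n => ?_
  refine integral_index_le h h' hupper
    (fun i j => centered ψ x₀ y₀ (gridPoint x₀ M n i) (gridPoint y₀ M n j)) ?_
    (monotone_gridIndex x₀ M n) (monotone_gridIndex y₀ M n) (N := 2 * M * (n + 1))
    (fun x => min_le_right _ _) (fun x => min_le_right _ _)
  intro k l
  have := hsuper _ _ _ _ (monotone_gridPoint x₀ M n k.le_succ)
    (monotone_gridPoint y₀ M n l.le_succ)
  simp only [Nat.succ_eq_add_one] at this
  simp only [centered]
  linarith

lemma isCoupling_prod [IsProbabilityMeasure μ] [IsProbabilityMeasure ν] :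
    IsCoupling (μ.prod ν) μ ν := by
  constructor
  · simp [Measure.map_fst_prod]
  · simp [Measure.map_snd_prod]

lemma integral_supermodular_le [IsProbabilityMeasure μ] [IsProbabilityMeasure ν]
    (h : IsCoupling γ μ ν) (h' : IsCoupling γ' μ ν)
    (hupper : ∀ A B : Set ℝ, IsUpperSet A → IsUpperSet B →
      MeasurableSet A → MeasurableSet B → γ.real (A ×ˢ B) ≤ γ'.real (A ×ˢ B))
    {ψ : ℝ → ℝ → ℝ}
    (hsuper : ∀ x₁ x₂ y₁ y₂ : ℝ, x₁ ≤ x₂ → y₁ ≤ y₂ →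
      ψ x₁ y₂ + ψ x₂ y₁ ≤ ψ x₁ y₁ + ψ x₂ y₂)
    (hrc : ∀ x y : ℝ,
      ContinuousWithinAt (fun p : ℝ × ℝ => ψ p.1 p.2) (Ici x ×ˢ Ici y) (x, y))
    (hint : ∀ γ : Measure (ℝ × ℝ), IsCoupling γ μ ν →
      Integrable (fun p => ψ p.1 p.2) γ) :
    ∫ p, ψ p.1 p.2 ∂γ ≤ ∫ p, ψ p.1 p.2 ∂γ' := by
  have hprod := hint _ isCoupling_prod
  obtain ⟨x₀, hx₀⟩ := hprod.prod_right_ae.exists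
  obtain ⟨y₀, hy₀⟩ := hprod.prod_left_ae.exists
  simp only at hx₀ hy₀
  have sect : ∀ {δ : Measure (ℝ × ℝ)}, IsCoupling δ μ ν →
      Integrable (fun p => centered ψ x₀ y₀ p.1 p.2) δ ∧
      ∫ p, centered ψ x₀ y₀ p.1 p.2 ∂δ =
        (∫ p, ψ p.1 p.2 ∂δ) - (∫ y, ψ x₀ y ∂ν) - (∫ x, ψ x y₀ ∂μ) + ψ x₀ y₀ := by
    intro δ hδ
    have := hδ.isProbabilityMeasure
    have j1 : Integrable (fun p : ℝ × ℝ => ψ x₀ p.2) δ :=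
      hδ.measurePreserving_snd.integrable_comp_of_integrable hx₀
    have j2 : Integrable (fun p : ℝ × ℝ => ψ p.1 y₀) δ :=
      hδ.measurePreserving_fst.integrable_comp_of_integrable hy₀
    have j0 := hint δ hδ
    have j01 : Integrable (fun p : ℝ × ℝ => ψ p.1 p.2 - ψ x₀ p.2) δ := j0.sub j1
    have j012 : Integrable (fun p : ℝ × ℝ => ψ p.1 p.2 - ψ x₀ p.2 - ψ p.1 y₀) δ := j01.sub j2
    refine ⟨j012.add (integrable_const _), ?_⟩
    unfold centered
    rw [integral_add j012 (integrable_const _),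
      integral_sub j01 j2, integral_sub j0 j1,
      hδ.integral_snd (f := fun y => ψ x₀ y) hx₀.aestronglyMeasurable,
      hδ.integral_fst (f := fun x => ψ x y₀) hy₀.aestronglyMeasurable]
    simp
  have key := integral_centered_le h h' hupper hsuper hrc x₀ y₀ (sect h).1 (sect h').1
  rw [(sect h).2, (sect h').2] at key
  linarith

end Couplings

section Quantile

variable {μ : Measure ℝ} [IsProbabilityMeasure μ]

lemma cdfOf_eq_cdf (x : ℝ) : cdfOf μ x = ProbabilityTheory.cdf μ x := by
  rw [ProbabilityTheory.cdf_eq_real]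
  rfl

/-- Galois connection between the quantile function and the distribution function. -/
lemma qf_le_iff {u : ℝ} (hu : u ∈ Ioo (0 : ℝ) 1) (x : ℝ) :
    qf (cdfOf μ) u ≤ x ↔ u ≤ cdfOf μ x := by
  have hF : cdfOf μ = ProbabilityTheory.cdf μ := funext cdfOf_eq_cdf
  rw [hF]
  set F := ProbabilityTheory.cdf μ
  have hbdd : BddBelow {x | u ≤ F x} := by
    obtain ⟨b, hb⟩ := ((ProbabilityTheory.tendsto_cdf_atBot μ).eventually_lt_const hu.1).exists
    refine ⟨b, fun y hy => ?_⟩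
    by_contra! hlt
    exact absurd (hy.trans (F.mono hlt.le)) (not_le.2 hb)
  have hne : {x | u ≤ F x}.Nonempty := by
    obtain ⟨b, hb⟩ := ((ProbabilityTheory.tendsto_cdf_atTop μ).eventually_const_lt hu.2).exists
    exact ⟨b, hb.le⟩
  constructor
  · intro h
    have hright : Tendsto F (𝓝[>] x) (𝓝 (F x)) :=
      (F.right_continuous x).mono_left (nhdsWithin_mono _ Ioi_subset_Ici_self)
    refine ge_of_tendsto hright ?_
    filter_upwards [self_mem_nhdsWithin] with y hy
    obtain ⟨z, hz, hzy⟩ := exists_lt_of_csInf_lt hne (lt_of_le_of_lt h hy)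
    exact le_trans hz (F.mono hzy.le)
  · exact fun h => csInf_le hbdd h

lemma monotoneOn_qf : MonotoneOn (qf (cdfOf μ)) (Ioo 0 1) := by
  intro u hu v hv huv
  rw [qf_le_iff hu]
  exact huv.trans ((qf_le_iff hv _).1 le_rfl)

variable (μ) in
lemma map_qf_restrict :
    (volume.restrict (Ioo (0 : ℝ) 1)).map (qf (cdfOf μ)) = μ := by
  have hm : AEMeasurable (qf (cdfOf μ)) (volume.restrict (Ioo (0 : ℝ) 1)) :=
    aemeasurable_restrict_of_monotoneOn measurableSet_Ioo monotoneOn_qf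
  have : IsProbabilityMeasure (volume.restrict (Ioo (0 : ℝ) 1)) := ⟨by simp⟩
  have := Measure.isProbabilityMeasure_map hm
  refine Measure.ext_of_Iic _ _ fun x => ?_
  have h1 : cdfOf μ x ≤ 1 := measureReal_le_one
  have h0 : 0 ≤ cdfOf μ x := ENNReal.toReal_nonneg
  rw [Measure.map_apply_of_aemeasurable hm measurableSet_Iic]
  have hae : (qf (cdfOf μ) ⁻¹' Iic x : Set ℝ) =ᵐ[volume.restrict (Ioo (0 : ℝ) 1)]
      Iic (cdfOf μ x) := by
    filter_upwards [ae_restrict_mem measurableSet_Ioo] with u hu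
    exact propext (qf_le_iff hu x)
  rw [measure_congr hae, restrict_Ioo_eq_restrict_Ioc,
    Measure.restrict_apply measurableSet_Iic, inter_comm, Ioc_inter_Iic, min_eq_right h1,
    Real.volume_Ioc, sub_zero]
  exact ENNReal.ofReal_toReal (measure_ne_top _ _)

end Quantile

section Comonotone

variable {α : Type*} [MeasurableSpace α] {P : Measure α} [IsProbabilityMeasure P]
  {μ ν : Measure ℝ} {γ : Measure (ℝ × ℝ)}

/-- Among all couplings, a comonotone one gives the largest mass to upper quadrants. -/
lemma measureReal_prod_le_of_comonotone [IsProbabilityMeasure μ]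
    {U : α → ℝ} {s : Set ℝ} (hUs : ∀ᵐ ω ∂P, U ω ∈ s) {f g : ℝ → ℝ}
    (hf : MonotoneOn f s) (hg : MonotoneOn g s)
    (hfU : AEMeasurable (fun ω => f (U ω)) P) (hgU : AEMeasurable (fun ω => g (U ω)) P)
    (hc : IsCoupling (P.map fun ω => (f (U ω), g (U ω))) μ ν) (h : IsCoupling γ μ ν)
    {A B : Set ℝ} (hA : IsUpperSet A) (hB : IsUpperSet B)
    (hAm : MeasurableSet A) (hBm : MeasurableSet B) :
    γ.real (A ×ˢ B) ≤ (P.map fun ω => (f (U ω), g (U ω))).real (A ×ˢ B) := by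
  have := h.isProbabilityMeasure
  have hpair := hfU.prodMk hgU
  have := hc.isProbabilityMeasure
  have nested : (∀ u ∈ s, f u ∈ A → g u ∈ B) ∨ (∀ u ∈ s, g u ∈ B → f u ∈ A) := by
    by_contra! hcon
    obtain ⟨⟨u, hu, hua, hub⟩, v, hv, hvb, hva⟩ := hcon
    rcases le_total u v with huv | huv
    · exact hva (hA (hf hu hv huv) hua)
    · exact hub (hB (hg hv hu huv) hvb)
  refine ENNReal.toReal_mono (measure_ne_top _ _) ?_
  rcases nested with hn | hn
  · calc γ (A ×ˢ B) ≤ γ (Prod.fst ⁻¹' A) := measure_mono fun p hp => hp.1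
      _ = (P.map fun ω => (f (U ω), g (U ω))) (Prod.fst ⁻¹' A) := by
        rw [h.measurePreserving_fst.measure_preimage hAm.nullMeasurableSet,
          hc.measurePreserving_fst.measure_preimage hAm.nullMeasurableSet]
      _ ≤ _ := by
        rw [Measure.map_apply_of_aemeasurable hpair (measurable_fst hAm),
          Measure.map_apply_of_aemeasurable hpair (hAm.prod hBm)]
        refine measure_mono_ae ?_
        filter_upwards [hUs] with ω hω hωA
        exact ⟨hωA, hn _ hω hωA⟩
  · calc γ (A ×ˢ B) ≤ γ (Prod.snd ⁻¹' B) := measure_mono fun p hp => hp.2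
      _ = (P.map fun ω => (f (U ω), g (U ω))) (Prod.snd ⁻¹' B) := by
        rw [h.measurePreserving_snd.measure_preimage hBm.nullMeasurableSet,
          hc.measurePreserving_snd.measure_preimage hBm.nullMeasurableSet]
      _ ≤ _ := by
        rw [Measure.map_apply_of_aemeasurable hpair (measurable_snd hBm),
          Measure.map_apply_of_aemeasurable hpair (hAm.prod hBm)]
        refine measure_mono_ae ?_
        filter_upwards [hUs] with ω hω hωB
        exact ⟨hn _ hω hωB, hωB⟩

end Comonotone

/-- Proposition 2.1 (Cambanis–Simons–Stout): for a right-continuous supermodular `ψ`,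
the supremum of `E[ψ(X', Y')]` over all couplings of the laws of `X` and `Y` is
attained by the common-uniform quantile coupling. -/
theorem stmt0
    {Ω : Type*} [MeasurableSpace Ω] (P : Measure Ω) [IsProbabilityMeasure P]
    (X Y U : Ω → ℝ) (hX : Measurable X) (hY : Measurable Y) (hU : Measurable U)
    (hUlaw : P.map U = volume.restrict (Ioo (0:ℝ) 1))
    (ψ : ℝ → ℝ → ℝ)
    (hsuper : ∀ x₁ x₂ y₁ y₂ : ℝ, x₁ ≤ x₂ → y₁ ≤ y₂ →
      ψ x₁ y₂ + ψ x₂ y₁ ≤ ψ x₁ y₁ + ψ x₂ y₂)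
    (hrc : ∀ x y : ℝ, ContinuousWithinAt (fun p : ℝ × ℝ => ψ p.1 p.2) (Ici x ×ˢ Ici y) (x, y))
    (hint : ∀ γ : Measure (ℝ × ℝ), IsCoupling γ (P.map X) (P.map Y) →
      Integrable (fun p => ψ p.1 p.2) γ) :
    sSup {r : ℝ | ∃ γ : Measure (ℝ × ℝ), IsCoupling γ (P.map X) (P.map Y) ∧
        r = ∫ p, ψ p.1 p.2 ∂γ}
      = ∫ ω, ψ (qf (cdfOf (P.map X)) (U ω)) (qf (cdfOf (P.map Y)) (U ω)) ∂P := by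
  have hPX : IsProbabilityMeasure (P.map X) := Measure.isProbabilityMeasure_map hX.aemeasurable
  have hPY : IsProbabilityMeasure (P.map Y) := Measure.isProbabilityMeasure_map hY.aemeasurable
  have hUs : ∀ᵐ ω ∂P, U ω ∈ Ioo (0 : ℝ) 1 := by
    refine ae_of_ae_map hU.aemeasurable ?_
    rw [hUlaw]
    exact ae_restrict_mem measurableSet_Ioo
  have quantile : ∀ (μ : Measure ℝ) [IsProbabilityMeasure μ],
      AEMeasurable (fun ω => qf (cdfOf μ) (U ω)) P ∧
      P.map (fun ω => qf (cdfOf μ) (U ω)) = μ := by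
    intro μ _
    have hm : AEMeasurable (qf (cdfOf μ)) (P.map U) := by
      rw [hUlaw]
      exact aemeasurable_restrict_of_monotoneOn measurableSet_Ioo monotoneOn_qf
    refine ⟨hm.comp_measurable hU, ?_⟩
    have := AEMeasurable.map_map_of_aemeasurable hm hU.aemeasurable
    rw [hUlaw, map_qf_restrict μ] at this
    exact this.symm
  obtain ⟨mX, lX⟩ := quantile (P.map X)
  obtain ⟨mY, lY⟩ := quantile (P.map Y)
  have hpair := mX.prodMk mY
  have hc : IsCoupling (P.map fun ω =>
      (qf (cdfOf (P.map X)) (U ω), qf (cdfOf (P.map Y)) (U ω))) (P.map X) (P.map Y) := by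
    constructor
    · rw [AEMeasurable.map_map_of_aemeasurable measurable_fst.aemeasurable hpair]
      exact lX
    · rw [AEMeasurable.map_map_of_aemeasurable measurable_snd.aemeasurable hpair]
      exact lY
  have hval := integral_map hpair (hint _ hc).aestronglyMeasurable
  refine IsGreatest.csSup_eq ⟨⟨_, hc, hval.symm⟩, ?_⟩
  rintro r ⟨γ, hγ, rfl⟩
  refine le_of_le_of_eq (integral_supermodular_le hγ hc (fun A B hA hB hAm hBm => ?_)
    hsuper hrc hint) hval
  exact measureReal_prod_le_of_comonotone hUs monotoneOn_qf monotoneOn_qf mX mY hc hγ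
    hA hB hAm hBm
end

section
/- Let G follow the Gamma distribution with shape α > 0 and rate 1, and let 0 < c₁ ≤ c₂ be constants. Then the total variation distance between the laws of c₁/G and c₂/G satisfies ‖ℒ(c₁/G) − ℒ(c₂/G)‖_TV ≤ 1 − (c₁/c₂)^α. -/
open MeasureTheory

/-- Total variation distance between two probability laws on `ℝ`:
`sup` over measurable sets of `|μ(A) - ν(A)|`. -/
noncomputable def tvDist (μ ν : Measure ℝ) : ℝ :=
  sSup {r : ℝ | ∃ s : Set ℝ, MeasurableSet s ∧ r = |(μ s).toReal - (ν s).toReal|}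

open ProbabilityTheory in
lemma rpow_mul_gammaPDF_le {α t : ℝ} (hα : 0 < α) (ht : 0 < t) (ht1 : t ≤ 1) (x : ℝ) :
    ENNReal.ofReal (t ^ α) * gammaPDF α 1 x ≤ ENNReal.ofReal t * gammaPDF α 1 (t * x) := by
  rcases lt_or_ge x 0 with hx | hx
  · simp [gammaPDF_of_neg hx]
  · rw [gammaPDF_of_nonneg hx, gammaPDF_of_nonneg (mul_nonneg ht.le hx),
      ← ENNReal.ofReal_mul (by positivity), ← ENNReal.ofReal_mul ht.le]
    apply ENNReal.ofReal_le_ofReal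
    have hpow : t ^ α = t * t ^ (α - 1) := by
      rw [Real.rpow_sub_one ht.ne']
      field_simp
    have hexp : Real.exp (-(1 * x)) ≤ Real.exp (-(1 * (t * x))) :=
      Real.exp_le_exp.2 (by nlinarith)
    have hΓ := Real.Gamma_pos_of_pos hα
    calc t ^ α * (1 ^ α / Real.Gamma α * x ^ (α - 1) * Real.exp (-(1 * x)))
        ≤ t ^ α * (1 ^ α / Real.Gamma α * x ^ (α - 1) * Real.exp (-(1 * (t * x)))) := by
          gcongr
      _ = t * (1 ^ α / Real.Gamma α * (t * x) ^ (α - 1) * Real.exp (-(1 * (t * x)))) := by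
          rw [Real.mul_rpow ht.le hx, hpow]
          ring

open ProbabilityTheory in
lemma rpow_mul_gammaMeasure_preimage_le {α t : ℝ} (hα : 0 < α) (ht : 0 < t) (ht1 : t ≤ 1)
    {A : Set ℝ} (hA : MeasurableSet A) :
    ENNReal.ofReal (t ^ α) * gammaMeasure α 1 ((t * ·) ⁻¹' A) ≤ gammaMeasure α 1 A := by
  have hpdf : Measurable (gammaPDF α 1) := (measurable_gammaPDFReal α 1).ennreal_ofReal
  have hmul : Measurable (t * · : ℝ → ℝ) := measurable_const_mul t
  rw [gammaMeasure, withDensity_apply _ (hmul hA), withDensity_apply _ hA,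
    ← lintegral_const_mul _ hpdf]
  calc ∫⁻ x in (t * ·) ⁻¹' A, ENNReal.ofReal (t ^ α) * gammaPDF α 1 x
      ≤ ∫⁻ x in (t * ·) ⁻¹' A, ENNReal.ofReal t * gammaPDF α 1 (t * x) :=
        lintegral_mono fun x => rpow_mul_gammaPDF_le hα ht ht1 x
    _ = ENNReal.ofReal t * ∫⁻ y in A, gammaPDF α 1 y ∂(volume.map (t * ·)) := by
        rw [setLIntegral_map hA hpdf hmul]
        exact lintegral_const_mul _ (hpdf.comp hmul)
    _ = ∫⁻ y in A, gammaPDF α 1 y := by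
        conv_rhs => rw [← Real.smul_map_volume_mul_left ht.ne', abs_of_pos ht]
        rw [Measure.restrict_smul, lintegral_smul_measure, smul_eq_mul]

lemma abs_measureReal_sub_le_of_mul_le {Ω : Type*} [MeasurableSpace Ω] {μ ν : Measure Ω}
    [IsProbabilityMeasure μ] [IsProbabilityMeasure ν] {r : ℝ} (hr1 : r ≤ 1)
    (h : ∀ s, MeasurableSet s → r * ν.real s ≤ μ.real s) {s : Set Ω} (hs : MeasurableSet s) :
    |μ.real s - ν.real s| ≤ 1 - r := by
  have key : ∀ u, MeasurableSet u → ν.real u - μ.real u ≤ 1 - r := fun u hu => by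
    nlinarith [h u hu, measureReal_le_one (μ := ν) (s := u)]
  have hc := key sᶜ hs.compl
  rw [probReal_compl_eq_one_sub hs, probReal_compl_eq_one_sub hs] at hc
  exact abs_le.2 ⟨by linarith [key s hs], by linarith⟩

/-- For `G ~ Gamma(α, 1)` and constants `0 < c₁ ≤ c₂`,
`‖ℒ(c₁/G) - ℒ(c₂/G)‖_TV ≤ 1 - (c₁/c₂)^α`. -/
theorem stmt14
    (α : ℝ) (hα : 0 < α) (c₁ c₂ : ℝ) (hc₁ : 0 < c₁) (hc : c₁ ≤ c₂) :
    tvDist ((ProbabilityTheory.gammaMeasure α 1).map fun g => c₁ / g)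
           ((ProbabilityTheory.gammaMeasure α 1).map fun g => c₂ / g)
      ≤ 1 - (c₁ / c₂) ^ α := by
  have := ProbabilityTheory.isProbabilityMeasure_gammaMeasure hα one_pos
  have hc₂ : 0 < c₂ := hc₁.trans_le hc
  have ht : 0 < c₁ / c₂ := div_pos hc₁ hc₂
  have ht1 : c₁ / c₂ ≤ 1 := (div_le_one hc₂).2 hc
  have hm (c : ℝ) : Measurable fun g : ℝ => c / g := measurable_const.div measurable_id
  have := Measure.isProbabilityMeasure_map (μ := ProbabilityTheory.gammaMeasure α 1)
    (hm c₁).aemeasurable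
  have := Measure.isProbabilityMeasure_map (μ := ProbabilityTheory.gammaMeasure α 1)
    (hm c₂).aemeasurable
  refine csSup_le ⟨_, ∅, MeasurableSet.empty, rfl⟩ ?_
  rintro _ ⟨s, hs, rfl⟩
  refine abs_measureReal_sub_le_of_mul_le (Real.rpow_le_one ht.le ht1 hα.le) (fun u hu => ?_) hs
  have hpre : (fun g : ℝ => c₂ / g) ⁻¹' u = (c₁ / c₂ * ·) ⁻¹' ((fun g : ℝ => c₁ / g) ⁻¹' u) := by
    ext g
    have : c₁ / (c₁ / c₂ * g) = c₂ / g := by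
      rw [← div_div, div_div_cancel₀ hc₁.ne']
    simp only [Set.mem_preimage, this]
  have hle := ENNReal.toReal_mono (measure_ne_top _ _)
    (rpow_mul_gammaMeasure_preimage_le hα ht ht1 (hm c₁ hu))
  rw [ENNReal.toReal_mul, ENNReal.toReal_ofReal (by positivity), ← hpre] at hle
  rwa [Measure.real, Measure.real, Measure.map_apply (hm c₁) hu, Measure.map_apply (hm c₂) hu]
end

section
/- Let α ≥ 1 and w₀ > 0. Let W and W' be random variables defined on a common probability space with W ≥ w₀ and W' ≥ w₀ almost surely and E|W − W'| < ∞, and let G ∼ Gamma(α, 1) be independent of (W, W'). Then the total variation distance between the laws of W/G and W'/G satisfies ‖ℒ(W/G) − ℒ(W'/G)‖_TV ≤ (α/w₀) E[|W − W'|]. -/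
open MeasureTheory

open ProbabilityTheory in
/-- The pushforward of a Gamma law of shape `a` under `x ↦ c * x`, `0 < c ≤ 1`, is dominated by
`c ^ (-a)` times the law itself. -/
lemma ofReal_rpow_mul_gammaMeasure_preimage_le {a r c : ℝ} (ha : 0 < a) (hr : 0 < r)
    (hc : 0 < c) (hc1 : c ≤ 1) {s : Set ℝ} (hs : MeasurableSet s) :
    ENNReal.ofReal (c ^ a) * gammaMeasure a r ((c * ·) ⁻¹' s) ≤ gammaMeasure a r s := by
  have hpdf : Measurable (gammaPDF a r) := (measurable_gammaPDFReal a r).ennreal_ofReal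
  have hmul : Measurable (fun x : ℝ => c * x) := measurable_const_mul c
  have hpoint (x : ℝ) :
      ENNReal.ofReal (c ^ a) * gammaPDF a r x ≤ ENNReal.ofReal c * gammaPDF a r (c * x) := by
    rcases lt_or_ge x 0 with hx | hx
    · simp [gammaPDF_of_neg hx]
    · rw [gammaPDF_of_nonneg hx, gammaPDF_of_nonneg (mul_nonneg hc.le hx),
        ← ENNReal.ofReal_mul (by positivity), ← ENNReal.ofReal_mul hc.le]
      apply ENNReal.ofReal_le_ofReal
      have hΓ := Real.Gamma_pos_of_pos ha
      have hexp : Real.exp (-(r * x)) ≤ Real.exp (-(r * (c * x))) := by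
        apply Real.exp_le_exp.mpr
        have : c * x ≤ x := mul_le_of_le_one_left hx hc1
        gcongr
      have hpow : c * c ^ (a - 1) = c ^ a := by
        rw [Real.rpow_sub_one hc.ne']
        field_simp
      calc c ^ a * (r ^ a / Real.Gamma a * x ^ (a - 1) * Real.exp (-(r * x)))
          ≤ c ^ a * (r ^ a / Real.Gamma a * x ^ (a - 1) * Real.exp (-(r * (c * x)))) := by
            gcongr
        _ = c * (r ^ a / Real.Gamma a * (c * x) ^ (a - 1) * Real.exp (-(r * (c * x)))) := by
            rw [Real.mul_rpow hc.le hx, ← hpow]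
            ring
  rw [gammaMeasure, withDensity_apply _ (hmul hs), withDensity_apply _ hs]
  conv_rhs => rw [← Real.smul_map_volume_mul_left hc.ne', abs_of_pos hc]
  rw [Measure.restrict_smul, lintegral_smul_measure, setLIntegral_map hs hpdf hmul, smul_eq_mul,
    ← lintegral_const_mul _ hpdf,
    ← lintegral_const_mul _ (show Measurable fun x => gammaPDF a r (c * x) from hpdf.comp hmul)]
  exact lintegral_mono hpoint

open ProbabilityTheory in
lemma gammaMeasure_real_div_sub_le_of_le {a r w w' : ℝ} (ha : 1 ≤ a) (hr : 0 < r)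
    (hw : 0 < w) (hww' : w ≤ w') {s : Set ℝ} (hs : MeasurableSet s) :
    (gammaMeasure a r).real ((w' / ·) ⁻¹' s) - (gammaMeasure a r).real ((w / ·) ⁻¹' s)
      ≤ a * ((w' - w) / w') := by
  have ha0 : 0 < a := one_pos.trans_le ha
  have hw' : 0 < w' := hw.trans_le hww'
  have := isProbabilityMeasure_gammaMeasure ha0 hr
  have hc : 0 < w / w' := div_pos hw hw'
  have hc1 : w / w' ≤ 1 := (div_le_one hw').mpr hww'
  have hset : (w / w' * ·) ⁻¹' ((w / ·) ⁻¹' s) = (w' / ·) ⁻¹' s := by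
    ext g
    simp only [Set.mem_preimage]
    rw [show w / (w / w' * g) = w' / g by field_simp]
  have h := ofReal_rpow_mul_gammaMeasure_preimage_le ha0 hr hc hc1
    ((measurable_id.const_div w) hs)
  have hreal := ENNReal.toReal_mono (measure_ne_top _ _) h
  simp only [id] at hreal
  rw [hset, ENNReal.toReal_mul, ENNReal.toReal_ofReal (by positivity)] at hreal
  change _ * (gammaMeasure a r).real _ ≤ (gammaMeasure a r).real _ at hreal
  have hbern := one_add_mul_self_le_rpow_one_add (s := w / w' - 1) (by linarith) ha
  rw [add_sub_cancel] at hbern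
  have hle : (gammaMeasure a r).real ((w' / ·) ⁻¹' s) ≤ 1 := measureReal_le_one
  have hpow : (w / w') ^ a ≤ 1 := Real.rpow_le_one hc.le hc1 ha0.le
  have heq : (w' - w) / w' = 1 - w / w' := by field_simp
  rw [heq]
  nlinarith

open ProbabilityTheory in
lemma abs_gammaMeasure_real_div_sub_le_of_le {a r w w' : ℝ} (ha : 1 ≤ a) (hr : 0 < r)
    (hw : 0 < w) (hww' : w ≤ w') {s : Set ℝ} (hs : MeasurableSet s) :
    |(gammaMeasure a r).real ((w / ·) ⁻¹' s) - (gammaMeasure a r).real ((w' / ·) ⁻¹' s)|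
      ≤ a * ((w' - w) / w') := by
  have := isProbabilityMeasure_gammaMeasure (one_pos.trans_le ha) hr
  have h := gammaMeasure_real_div_sub_le_of_le ha hr hw hww' hs
  have hcompl := gammaMeasure_real_div_sub_le_of_le ha hr hw hww' hs.compl
  have hmeas (v : ℝ) : MeasurableSet ((v / ·) ⁻¹' s) := (measurable_id.const_div v) hs
  rw [Set.preimage_compl, Set.preimage_compl, probReal_compl_eq_one_sub (hmeas w),
    probReal_compl_eq_one_sub (hmeas w')] at hcompl
  exact abs_le.mpr ⟨by linarith, by linarith⟩

open ProbabilityTheory in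
/-- The total variation distance between the laws of `w / G` and `w' / G`, for `G` with a Gamma law
of shape `a ≥ 1`, is Lipschitz in the numerator. -/
lemma abs_gammaMeasure_real_div_sub_le {a r w₀ w w' : ℝ} (ha : 1 ≤ a) (hr : 0 < r)
    (hw₀ : 0 < w₀) (hw : w₀ ≤ w) (hw' : w₀ ≤ w') {s : Set ℝ} (hs : MeasurableSet s) :
    |(gammaMeasure a r).real ((w / ·) ⁻¹' s) - (gammaMeasure a r).real ((w' / ·) ⁻¹' s)|
      ≤ a / w₀ * |w - w'| := by
  wlog hww' : w ≤ w' generalizing w w'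
  · rw [abs_sub_comm, abs_sub_comm w]
    exact this hw' hw (le_of_not_ge hww')
  refine (abs_gammaMeasure_real_div_sub_le_of_le ha hr (hw₀.trans_le hw) hww' hs).trans ?_
  rw [abs_sub_comm, abs_of_nonneg (sub_nonneg.mpr hww'), div_mul_eq_mul_div, mul_div_assoc]
  have := sub_nonneg.mpr hww'
  gcongr

open ProbabilityTheory in
/-- Disintegration of the law of a quotient of independent variables along the numerator. -/
lemma ProbabilityTheory.IndepFun.map_div_apply {Ω : Type*} [MeasurableSpace Ω] {P : Measure Ω}
    [IsProbabilityMeasure P] {X G : Ω → ℝ} (hindep : IndepFun X G P) (hX : Measurable X)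
    (hG : Measurable G) {s : Set ℝ} (hs : MeasurableSet s) :
    P.map (fun ω => X ω / G ω) s = ∫⁻ ω, P.map G ((X ω / ·) ⁻¹' s) ∂P := by
  have := Measure.isProbabilityMeasure_map (μ := P) hG.aemeasurable
  have hdiv : Measurable (fun p : ℝ × ℝ => p.1 / p.2) := measurable_fst.div measurable_snd
  have hprod := (indepFun_iff_map_prod_eq_prod_map_map hX.aemeasurable hG.aemeasurable).mp hindep
  rw [show (fun ω => X ω / G ω) = (fun p : ℝ × ℝ => p.1 / p.2) ∘ (fun ω => (X ω, G ω)) from rfl,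
    ← Measure.map_map hdiv (hX.prodMk hG), hprod, Measure.map_apply hdiv hs,
    Measure.prod_apply (hdiv hs), lintegral_map (measurable_measure_prodMk_left (hdiv hs)) hX]
  rfl

lemma measurable_measure_div_preimage {ν : Measure ℝ} [SFinite ν] {s : Set ℝ}
    (hs : MeasurableSet s) : Measurable fun x : ℝ => ν ((x / ·) ⁻¹' s) :=
  measurable_measure_prodMk_left ((measurable_fst.div measurable_snd) hs)

/-- One-step contraction estimate (inside Lemma 5.2): for `α ≥ 1`, `w₀ > 0`,
random variables `W, W' ≥ w₀` a.s. and `G ~ Gamma(α,1)` independent of `(W, W')`,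
`‖ℒ(W/G) - ℒ(W'/G)‖_TV ≤ (α/w₀) E[|W - W'|]`. -/
theorem stmt15
    {Ω : Type*} [MeasurableSpace Ω] (P : Measure Ω) [IsProbabilityMeasure P]
    (α w₀ : ℝ) (hα : 1 ≤ α) (hw₀ : 0 < w₀)
    (W W' G : Ω → ℝ) (hW : Measurable W) (hW' : Measurable W') (hG : Measurable G)
    (hWlb : ∀ᵐ ω ∂P, w₀ ≤ W ω) (hW'lb : ∀ᵐ ω ∂P, w₀ ≤ W' ω)
    (hint : Integrable (fun ω => |W ω - W' ω|) P)
    (hGlaw : P.map G = ProbabilityTheory.gammaMeasure α 1)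
    (hindep : ProbabilityTheory.IndepFun (fun ω => (W ω, W' ω)) G P) :
    tvDist (P.map fun ω => W ω / G ω) (P.map fun ω => W' ω / G ω)
      ≤ (α / w₀) * ∫ ω, |W ω - W' ω| ∂P := by
  have := ProbabilityTheory.isProbabilityMeasure_gammaMeasure (one_pos.trans_le hα) one_pos
  have hrhs : 0 ≤ (α / w₀) * ∫ ω, |W ω - W' ω| ∂P :=
    mul_nonneg (by positivity) (integral_nonneg fun _ => abs_nonneg _)
  refine Real.sSup_le ?_ hrhs
  rintro _ ⟨s, hs, rfl⟩
  set γ := ProbabilityTheory.gammaMeasure α 1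
  have hmeas {X : Ω → ℝ} (hX : Measurable X) : Measurable fun ω => γ ((X ω / ·) ⁻¹' s) :=
    (measurable_measure_div_preimage hs).comp hX
  have hInt {X : Ω → ℝ} (hX : Measurable X) :
      Integrable (fun ω => γ.real ((X ω / ·) ⁻¹' s)) P :=
    Integrable.of_bound (hmeas hX).ennreal_toReal.aestronglyMeasurable 1
      (ae_of_all _ fun ω => by
        rw [Real.norm_of_nonneg measureReal_nonneg]
        exact measureReal_le_one)
  have hlaw {X : Ω → ℝ} (hX : Measurable X) (hXG : ProbabilityTheory.IndepFun X G P) :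
      (P.map (fun ω => X ω / G ω) s).toReal = ∫ ω, γ.real ((X ω / ·) ⁻¹' s) ∂P := by
    rw [hXG.map_div_apply hX hG hs, hGlaw]
    exact (integral_toReal (hmeas hX).aemeasurable (ae_of_all _ fun _ => measure_lt_top _ _)).symm
  rw [hlaw hW (hindep.comp measurable_fst measurable_id),
    hlaw hW' (hindep.comp measurable_snd measurable_id), ← integral_sub (hInt hW) (hInt hW'),
    ← integral_const_mul]
  refine abs_integral_le_integral_abs.trans
    (integral_mono_ae ((hInt hW).sub (hInt hW')).abs (hint.const_mul _) ?_)
  filter_upwards [hWlb, hW'lb] with ω h h'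
  exact abs_gammaMeasure_real_div_sub_le hα one_pos hw₀ h h' hs
end
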